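/- Suppose B is coprime to MN and let B⁻¹ denote an integer inverse of B modulo MN. For k, l ∈ ℤ/(MN)ℤ set s = 2Ak − l, k̄ = −B⁻¹ s, and l̄ = 2C B⁻¹ s − B k (all computed in ℤ/(MN)ℤ). Then for all x, y : ℤ/(MN)ℤ → ℂ and all k, l ∈ ℤ/(MN)ℤ, A_{F_a y, F_a x}[k, l] = e^{(2πi/(MN))(−A k² + l k + C (B⁻¹)² s²)} · A_{y,x}[k̄, l̄]. -/

import Mathlib

open Finset

/-- e^{2πi t / Q} for an integer `t` and modulus `Q`. -/
noncomputable def eFrac (Q : ℕ) (t : ℤ) : ℂ :=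
  Complex.exp (2 * Real.pi * Complex.I * (t : ℂ) / (Q : ℂ))

/-- Generalized discrete affine Fourier transform (GDAFT). -/
noncomputable def gdaft (M N : ℕ) (A B C : ℤ) (x : ZMod (M * N) → ℂ) :
    ZMod (M * N) → ℂ :=
  fun n => (Real.sqrt (M * N) : ℂ)⁻¹ *
    ∑ m ∈ Finset.range (M * N),
      eFrac (M * N) (A * (n.val : ℤ) ^ 2 + B * (n.val : ℤ) * (m : ℤ) + C * (m : ℤ) ^ 2) *
        x (m : ZMod (M * N))

/-- Inverse GDAFT. -/
noncomputable def igdaft (M N : ℕ) (A B C : ℤ) (x : ZMod (M * N) → ℂ) :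
    ZMod (M * N) → ℂ :=
  fun m => (Real.sqrt (M * N) : ℂ)⁻¹ *
    ∑ n ∈ Finset.range (M * N),
      eFrac (M * N) (-(A * (n : ℤ) ^ 2 + B * (n : ℤ) * (m.val : ℤ) + C * (m.val : ℤ) ^ 2)) *
        x (n : ZMod (M * N))

/-- The pulsone localized at `(k0, l0)`. -/
noncomputable def pulsone (M N : ℕ) (k0 l0 : ℕ) : ZMod (M * N) → ℂ :=
  fun n => if n.val % M = k0 then
    (Real.sqrt N : ℂ)⁻¹ * eFrac N ((n.val / M : ℕ) * l0) else 0

/-- Cross-ambiguity function of two `MN`-periodic sequences. -/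
noncomputable def amb (M N : ℕ) (y x : ZMod (M * N) → ℂ) (k l : ZMod (M * N)) : ℂ :=
  ((M * N : ℕ) : ℂ)⁻¹ * ∑ n ∈ Finset.range (M * N),
    y (n : ZMod (M * N)) * (starRingEnd ℂ) (x ((n : ZMod (M * N)) - k)) *
      eFrac (M * N) (-((l * ((n : ZMod (M * N)) - k)).val : ℤ))

/-- Delay-Doppler shift operator. -/
noncomputable def ddShift (M N : ℕ) (k l : ZMod (M * N)) (x : ZMod (M * N) → ℂ) :
    ZMod (M * N) → ℂ :=
  fun n => x (n - k) * eFrac (M * N) ((l * (n - k)).val : ℤ)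

/-- Inner product ⟨x, y⟩ = Σ x[n] conj(y[n]). -/
noncomputable def innerMN (M N : ℕ) (x y : ZMod (M * N) → ℂ) : ℂ :=
  ∑ n ∈ Finset.range (M * N),
    x (n : ZMod (M * N)) * (starRingEnd ℂ) (y (n : ZMod (M * N)))


theorem eFrac_eq_stdAddChar (Q : ℕ) [NeZero Q] (t : ℤ) :
    eFrac Q t = ZMod.stdAddChar (t : ZMod Q) := by
  rw [ZMod.stdAddChar_coe, eFrac]

theorem sum_range_natCast_zmod (Q : ℕ) [NeZero Q] (f : ZMod Q → ℂ) :
    ∑ n ∈ Finset.range Q, f (n : ZMod Q) = ∑ n, f n := by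
  refine Finset.sum_bij' (fun n _ => (n : ZMod Q)) (fun n _ => n.val) ?_ ?_ ?_ ?_ ?_
  · simp
  · intro n _
    exact Finset.mem_range.2 (ZMod.val_lt n)
  · intro n hn
    exact ZMod.val_cast_of_lt (Finset.mem_range.1 hn)
  · intro n _
    exact ZMod.natCast_zmod_val n
  · simp

theorem gdaft_eq_sum_stdAddChar (M N : ℕ) [NeZero (M * N)] (A B C : ℤ)
    (x : ZMod (M * N) → ℂ) (n : ZMod (M * N)) :
    gdaft M N A B C x n = (Real.sqrt (M * N) : ℂ)⁻¹ *
      ∑ m, ZMod.stdAddChar (A * n ^ 2 + B * n * m + C * m ^ 2 : ZMod (M * N)) * x m := by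
  rw [gdaft, ← sum_range_natCast_zmod]
  simp [eFrac_eq_stdAddChar]

theorem amb_eq_sum_stdAddChar (M N : ℕ) [NeZero (M * N)] (y x : ZMod (M * N) → ℂ)
    (k l : ZMod (M * N)) :
    amb M N y x k l = ((M * N : ℕ) : ℂ)⁻¹ *
      ∑ n, y n * (starRingEnd ℂ) (x (n - k)) * ZMod.stdAddChar (-(l * (n - k))) := by
  rw [amb, ← sum_range_natCast_zmod]
  simp [eFrac_eq_stdAddChar]

/-- The covariance of the ambiguity sum under a quadratic-phase transform with kernel
`ψ (a n² + b n m + c m²)`, for a primitive additive character `ψ` of a finite ring. -/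
theorem sum_quadratic_phase_ambiguity {R : Type*} [CommRing R] [Fintype R]
    {ψ : AddChar R ℂ} (hψ : ψ.IsPrimitive) (a b c d k l : R) (hbd : b * d = 1)
    (x y : R → ℂ) :
    ∑ n, (∑ m, ψ (a * n ^ 2 + b * n * m + c * m ^ 2) * y m) *
        (starRingEnd ℂ)
          (∑ m, ψ (a * (n - k) ^ 2 + b * (n - k) * m + c * m ^ 2) * x m) *
        ψ (-(l * (n - k))) =
      Fintype.card R * (ψ (-a * k ^ 2 + l * k + c * d ^ 2 * (2 * a * k - l) ^ 2) *
        ∑ m, y m * (starRingEnd ℂ) (x (m - -d * (2 * a * k - l))) *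
          ψ (-((2 * c * d * (2 * a * k - l) - b * k) * (m - -d * (2 * a * k - l))))) := by
  classical
  have phase (n m m' : R) :
      ψ (a * n ^ 2 + b * n * m + c * m ^ 2) * y m *
          (starRingEnd ℂ) (ψ (a * (n - k) ^ 2 + b * (n - k) * m' + c * m' ^ 2) * x m') *
          ψ (-(l * (n - k))) =
        y m * (starRingEnd ℂ) (x m') *
          ψ (-a * k ^ 2 + l * k + b * k * m' + c * (m ^ 2 - m' ^ 2)) *
          ψ (n * (2 * a * k - l + b * (m - m'))) := by
    have hexp : ψ (a * n ^ 2 + b * n * m + c * m ^ 2) *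
          ψ (-(a * (n - k) ^ 2 + b * (n - k) * m' + c * m' ^ 2)) * ψ (-(l * (n - k))) =
        ψ (-a * k ^ 2 + l * k + b * k * m' + c * (m ^ 2 - m' ^ 2)) *
          ψ (n * (2 * a * k - l + b * (m - m'))) := by
      simp only [← AddChar.map_add_eq_mul]
      congr 1
      ring
    rw [map_mul, ← AddChar.map_neg_eq_conj]
    linear_combination (y m * (starRingEnd ℂ) (x m')) * hexp
  have resonance (m m' : R) :
      2 * a * k - l + b * (m - m') = 0 ↔ m' = m - -d * (2 * a * k - l) := by
    constructor <;> intro h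
    · linear_combination (m - m') * hbd - d * h
    · linear_combination (-b) * h - (2 * a * k - l) * hbd
  calc
    _ = ∑ n, ∑ m, ∑ m', y m * (starRingEnd ℂ) (x m') *
          ψ (-a * k ^ 2 + l * k + b * k * m' + c * (m ^ 2 - m' ^ 2)) *
          ψ (n * (2 * a * k - l + b * (m - m'))) := by
      refine Finset.sum_congr rfl fun n _ => ?_
      rw [map_sum, Finset.sum_mul_sum, Finset.sum_mul]
      refine Finset.sum_congr rfl fun m _ => ?_
      rw [Finset.sum_mul]
      exact Finset.sum_congr rfl fun m' _ => phase n m m'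
    _ = ∑ m, ∑ m', y m * (starRingEnd ℂ) (x m') *
          ψ (-a * k ^ 2 + l * k + b * k * m' + c * (m ^ 2 - m' ^ 2)) *
          if m' = m - -d * (2 * a * k - l) then (Fintype.card R : ℂ) else 0 := by
      rw [Finset.sum_comm]
      refine Finset.sum_congr rfl fun m _ => ?_
      rw [Finset.sum_comm]
      refine Finset.sum_congr rfl fun m' _ => ?_
      rw [← Finset.mul_sum, AddChar.sum_mulShift _ hψ]
      simp only [resonance, Nat.cast_ite, Nat.cast_zero]
    _ = _ := by
      rw [Finset.mul_sum, Finset.mul_sum]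
      refine Finset.sum_congr rfl fun m _ => ?_
      simp only [mul_ite, mul_zero, Finset.sum_ite_eq', Finset.mem_univ, if_true]
      have hexp : ψ (-a * k ^ 2 + l * k + b * k * (m - -d * (2 * a * k - l)) +
            c * (m ^ 2 - (m - -d * (2 * a * k - l)) ^ 2)) =
          ψ (-a * k ^ 2 + l * k + c * d ^ 2 * (2 * a * k - l) ^ 2) *
            ψ (-((2 * c * d * (2 * a * k - l) - b * k) * (m - -d * (2 * a * k - l)))) := by
        rw [← AddChar.map_add_eq_mul]
        congr 1
        ring
      rw [hexp]
      ring

/-- **Cross-ambiguity of GDAFTs.** If `B` is coprime to `M*N` with integer inverse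
`Binv` modulo `M*N`, then with `s = 2Ak − l`, `k̄ = −B⁻¹s`, `l̄ = 2CB⁻¹s − Bk`
(computed in `ℤ/(MN)ℤ`), we have
`A_{F_a y, F_a x}[k,l] = e^{(2πi/(MN))(−Ak² + lk + C(B⁻¹)² s²)} · A_{y,x}[k̄, l̄]`. -/
theorem amb_gdaft (M N : ℕ) (hM : 0 < M) (hN : 0 < N) (A B C : ℤ)
    (hB : IsCoprime B ((M * N : ℕ) : ℤ))
    (Binv : ℤ) (hBinv : B * Binv ≡ 1 [ZMOD ((M * N : ℕ) : ℤ)]) :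
    ∀ (x y : ZMod (M * N) → ℂ) (k l : ZMod (M * N)) (s kbar lbar : ZMod (M * N)),
      s = 2 * (A : ZMod (M * N)) * k - l →
      kbar = -(Binv : ZMod (M * N)) * s →
      lbar = 2 * (C : ZMod (M * N)) * (Binv : ZMod (M * N)) * s - (B : ZMod (M * N)) * k →
      amb M N (gdaft M N A B C y) (gdaft M N A B C x) k l =
        eFrac (M * N)
          (((-(A : ZMod (M * N)) * k ^ 2 + l * k +
              (C : ZMod (M * N)) * (Binv : ZMod (M * N)) ^ 2 * s ^ 2).val : ℤ)) *
          amb M N y x kbar lbar := by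
  rintro x y k l s kbar lbar rfl rfl rfl
  have : NeZero (M * N) := ⟨(Nat.mul_pos hM hN).ne'⟩
  have hd : (B : ZMod (M * N)) * Binv = 1 := by
    exact_mod_cast (ZMod.intCast_eq_intCast_iff _ _ _).2 hBinv
  have hsqrt : (Real.sqrt (M * N) : ℂ)⁻¹ * (Real.sqrt (M * N) : ℂ)⁻¹ * (M * N : ℕ) = 1 := by
    have hpos : (0 : ℝ) < M * N := by positivity
    have hsq : (Real.sqrt (M * N) : ℂ) * Real.sqrt (M * N) = (M * N : ℕ) := by
      exact_mod_cast Real.mul_self_sqrt hpos.le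
    rw [← mul_inv, hsq, inv_mul_cancel₀ (NeZero.ne _)]
  have key := sum_quadratic_phase_ambiguity (ZMod.isPrimitive_stdAddChar (M * N))
    (A : ZMod (M * N)) B C Binv k l hd x y
  rw [ZMod.card] at key
  simp only [amb_eq_sum_stdAddChar, gdaft_eq_sum_stdAddChar, eFrac_eq_stdAddChar, Int.cast_natCast,
    ZMod.natCast_zmod_val]
  have factor (u v w : ℂ) :
      (Real.sqrt (M * N) : ℂ)⁻¹ * u *
          (starRingEnd ℂ) ((Real.sqrt (M * N) : ℂ)⁻¹ * v) * w =
        (Real.sqrt (M * N) : ℂ)⁻¹ * (Real.sqrt (M * N) : ℂ)⁻¹ *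
          (u * (starRingEnd ℂ) v * w) := by
    rw [map_mul, map_inv₀, Complex.conj_ofReal]
    ring
  simp only [factor, ← Finset.mul_sum]
  rw [key, ← mul_assoc (_ * _) ((M * N : ℕ) : ℂ), hsqrt, one_mul, mul_left_comm]
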